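/- Let f be the Collatz map, H a complex Hilbert space with orthonormal basis {e_n}_{n≥1}, and T1, T2 the bounded operators with T1 e_n = e_{3n+1} for n odd, T1 e_n = 0 for n even, T2 e_n = e_{n/2} for n even, T2 e_n = 0 for n odd. Then the following are equivalent: (i) C*(T1,T2) has no non-trivial reducing subspaces; (ii) the Collatz conjecture holds, i.e. 1 ∈ orb(n;f) for every n ≥ 1. -/

import Mathlib

/-- The Collatz map on positive integers: `3n+1` for odd `n`, `n/2` for even `n`. -/
def collatz (n : ℕ+) : ℕ+ :=
  if h : (n : ℕ) % 2 = 1 then 3 * n + 1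
  else ⟨(n : ℕ) / 2, by
    have h2 : 0 < n.1 := n.2
    have h3 : ¬ n.1 % 2 = 1 := h
    show 0 < n.1 / 2
    omega⟩

/-- The forward orbit of `x` under `f`. -/
def orbit {X : Type*} (f : X → X) (x : X) : Set X := Set.range fun k => f^[k] x

/-- The orbit equivalence relation induced by `f`: `x ~ y` iff the orbits meet. -/
def orbEquiv {X : Type*} (f : X → X) (x y : X) : Prop :=
  (orbit f x ∩ orbit f y).Nonempty

/-- The C*-algebra of operators generated by a set `S` of bounded operators on a complex
Hilbert space: the closure of the (non-unital) star subalgebra generated by `S`. -/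
noncomputable def CstarGen {H : Type*} [NormedAddCommGroup H] [InnerProductSpace ℂ H]
    [CompleteSpace H] (S : Set (H →L[ℂ] H)) : Set (H →L[ℂ] H) :=
  closure (NonUnitalStarAlgebra.adjoin ℂ S : Set (H →L[ℂ] H))


/-- `T` acts as the Collatz shift on the basis vectors of parity `r`, and kills the others. -/
def IsShift {H : Type*} [NormedAddCommGroup H] [InnerProductSpace ℂ H]
    [CompleteSpace H] (b : HilbertBasis ℕ+ ℂ H) (r : ℕ) (T : H →L[ℂ] H) : Prop :=
  ∀ n : ℕ+, T (b n) = if (n : ℕ) % 2 = r then b (collatz n) else 0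

lemma collatz_odd (n : ℕ+) (h : (n : ℕ) % 2 = 1) : ((collatz n : ℕ+) : ℕ) = 3 * n + 1 := by
  simp [collatz, h]

lemma collatz_even (n : ℕ+) (h : (n : ℕ) % 2 = 0) : ((collatz n : ℕ+) : ℕ) = n / 2 := by
  simp [collatz, h]

lemma collatz_inj (m n : ℕ+) (h : (m : ℕ) % 2 = (n : ℕ) % 2) (e : collatz m = collatz n) :
    m = n := by
  have e' := congrArg (fun k : ℕ+ => (k : ℕ)) e
  apply PNat.eq
  rcases Nat.mod_two_eq_zero_or_one n with hn | hn
  · have hm := h.trans hn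
    simp only [collatz_even _ hn, collatz_even _ hm] at e'
    omega
  · have hm := h.trans hn
    simp only [collatz_odd _ hn, collatz_odd _ hm] at e'
    omega

section
variable {H : Type*} [NormedAddCommGroup H] [InnerProductSpace ℂ H] [CompleteSpace H]

lemma basis_ext (b : HilbertBasis ℕ+ ℂ H) (x y : H)
    (h : ∀ n, inner ℂ (b n) x = inner ℂ (b n) y) : x = y := by
  apply b.repr.injective
  ext n
  simpa [b.repr_apply_apply] using h n

lemma inner_basis (b : HilbertBasis ℕ+ ℂ H) (m n : ℕ+) :
    inner ℂ (b m) (b n) = if m = n then (1 : ℂ) else 0 :=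
  orthonormal_iff_ite.mp b.orthonormal m n

lemma adj_shift (b : HilbertBasis ℕ+ ℂ H) (r : ℕ) (T : H →L[ℂ] H) (hT : IsShift b r T)
    (n : ℕ+) (hn : (n : ℕ) % 2 = r) : ContinuousLinearMap.adjoint T (b (collatz n)) = b n := by
  apply basis_ext b
  intro m
  rw [ContinuousLinearMap.adjoint_inner_right, hT m, inner_basis]
  by_cases hm : (m : ℕ) % 2 = r
  · rw [if_pos hm, inner_basis]
    by_cases e : m = n
    · simp [e]
    · rw [if_neg e, if_neg]
      exact fun e' => e (collatz_inj m n (hm.trans hn.symm) e')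
  · rw [if_neg hm, inner_zero_left, if_neg]
    rintro rfl
    exact hm hn

lemma adj_shift_zero (b : HilbertBasis ℕ+ ℂ H) (r : ℕ) (T : H →L[ℂ] H) (hT : IsShift b r T)
    (n : ℕ+) (hn : ∀ k : ℕ+, (k : ℕ) % 2 = r → collatz k ≠ n) :
    ContinuousLinearMap.adjoint T (b n) = 0 := by
  apply basis_ext b
  intro m
  rw [ContinuousLinearMap.adjoint_inner_right, hT m, inner_zero_right]
  by_cases hm : (m : ℕ) % 2 = r
  · rw [if_pos hm, inner_basis, if_neg (hn m hm)]
  · rw [if_neg hm, inner_zero_left]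

lemma gen_invariant (S : Set (H →L[ℂ] H)) (M : Submodule ℂ H) (hM : IsClosed (M : Set H))
    (h : ∀ A ∈ S, ∀ x ∈ M, A x ∈ M ∧ ContinuousLinearMap.adjoint A x ∈ M) :
    ∀ A ∈ CstarGen S, ∀ x ∈ M, A x ∈ M ∧ ContinuousLinearMap.adjoint A x ∈ M := by
  have key : CstarGen S ⊆
      {A | ∀ x ∈ M, A x ∈ M ∧ ContinuousLinearMap.adjoint A x ∈ M} := by
    apply closure_minimal
    · intro A hA
      refine NonUnitalStarAlgebra.adjoin_induction (R := ℂ) (s := S)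
        (p := fun A _ => ∀ x ∈ M, A x ∈ M ∧ ContinuousLinearMap.adjoint A x ∈ M)
        (fun A hA => h A hA) ?_ ?_ ?_ ?_ ?_ hA
      · intro A B _ _ hA hB x hx
        rw [map_add]
        exact ⟨M.add_mem (hA x hx).1 (hB x hx).1, M.add_mem (hA x hx).2 (hB x hx).2⟩
      · intro x hx
        simp
      · intro A B _ _ hA hB x hx
        refine ⟨(hA _ (hB x hx).1).1, ?_⟩
        have : ContinuousLinearMap.adjoint (A * B) =
          ContinuousLinearMap.adjoint B * ContinuousLinearMap.adjoint A :=
            ContinuousLinearMap.adjoint_comp A B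
        rw [this]
        exact (hB _ (hA x hx).2).2
      · intro c A _ hA x hx
        refine ⟨M.smul_mem c (hA x hx).1, ?_⟩
        rw [map_smulₛₗ]
        exact M.smul_mem _ (hA x hx).2
      · intro A _ hA x hx
        rw [ContinuousLinearMap.star_eq_adjoint, ContinuousLinearMap.adjoint_adjoint]
        exact (hA x hx).symm
    · simp only [Set.ofPred_forall]
      refine isClosed_iInter fun x => isClosed_iInter fun _ => IsClosed.inter ?_ ?_
      · exact hM.preimage (by fun_prop : Continuous fun A : H →L[ℂ] H => A x)
      · have c : Continuous fun A : H →L[ℂ] H => ContinuousLinearMap.adjoint A :=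
          ContinuousLinearMap.adjoint.continuous
        exact hM.preimage
          ((by fun_prop : Continuous fun A : H →L[ℂ] H => A x).comp c)
  exact key

lemma top_of_one_mem (b : HilbertBasis ℕ+ ℂ H) (T1 T2 : H →L[ℂ] H) (h1 : IsShift b 1 T1)
    (h2 : IsShift b 0 T2) (hc : ∀ m : ℕ+, (1 : ℕ+) ∈ orbit collatz m)
    (M : Submodule ℂ H) (hM : IsClosed (M : Set H))
    (m1 : ∀ x ∈ M, ContinuousLinearMap.adjoint T1 x ∈ M)
    (m2 : ∀ x ∈ M, ContinuousLinearMap.adjoint T2 x ∈ M) (hb : b 1 ∈ M) : M = ⊤ := by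
  have step : ∀ n, b (collatz n) ∈ M → b n ∈ M := by
    intro n hn
    rcases Nat.mod_two_eq_zero_or_one n with h | h
    · rw [← adj_shift b 0 T2 h2 n h]
      exact m2 _ hn
    · rw [← adj_shift b 1 T1 h1 n h]
      exact m1 _ hn
  have iter : ∀ k n, b (collatz^[k] n) ∈ M → b n ∈ M := by
    intro k
    induction k with
    | zero => exact fun n h => h
    | succ k ih =>
      intro n h
      rw [Function.iterate_succ_apply] at h
      exact step n (ih _ h)
  have all : ∀ n, b n ∈ M := by
    intro n
    obtain ⟨k, hk⟩ := hc n
    apply iter k n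
    simp only at hk
    rwa [hk]
  rw [eq_top_iff, ← b.dense_span]
  apply Submodule.topologicalClosure_minimal _ _ hM
  rw [Submodule.span_le]
  rintro _ ⟨n, rfl⟩
  exact all n

lemma fixed_mem (b : HilbertBasis ℕ+ ℂ H) (T1 T2 : H →L[ℂ] H) (h1 : IsShift b 1 T1)
    (h2 : IsShift b 0 T2) (x : H)
    (hx : ContinuousLinearMap.adjoint T1 (ContinuousLinearMap.adjoint T2
      (ContinuousLinearMap.adjoint T2 x)) = x) : x = (inner ℂ (b 1) x : ℂ) • b 1 := by
  have hn : ∀ N : ℕ, ∀ n : ℕ+, (n : ℕ) = N → n ≠ 1 → inner ℂ (b n) x = (0 : ℂ) := by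
    intro N
    induction N using Nat.strong_induction_on with
    | _ N ih =>
      intro n hN h
      have hgt : (n : ℕ) ≠ 1 := fun e => h (PNat.eq e)
      have hpos := n.pos
      rw [← hx, ContinuousLinearMap.adjoint_inner_right, ContinuousLinearMap.adjoint_inner_right,
        ContinuousLinearMap.adjoint_inner_right, h1 n]
      split_ifs with a1
      · have v1 := collatz_odd n a1
        rw [h2]
        split_ifs with a2
        · have v2 := collatz_even _ a2
          rw [h2]
          split_ifs with a3
          · have v3 := collatz_even _ a3
            refine ih (collatz (collatz (collatz n)) : ℕ+) (by omega) _ rfl ?_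
            intro e
            have e' := congrArg (fun k : ℕ+ => (k : ℕ)) e
            simp only [PNat.one_coe] at e'
            omega
          · exact inner_zero_left _
        · simp
      · simp
  apply basis_ext b
  intro n
  rw [inner_smul_right, inner_basis]
  by_cases e : n = 1
  · simp [e]
  · simp [e, hn n n rfl e]
end

/-- `C*(T₁,T₂)` has no non-trivial reducing subspaces iff the Collatz conjecture holds. -/
theorem irreducible_pair_iff_collatz {H : Type*} [NormedAddCommGroup H] [InnerProductSpace ℂ H]
    [CompleteSpace H] (b : HilbertBasis ℕ+ ℂ H)
    (T1 T2 : H →L[ℂ] H)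
    (hT1 : ∀ n : ℕ+, T1 (b n) = if (n : ℕ) % 2 = 1 then b (3 * n + 1) else 0)
    (hT2 : ∀ n : ℕ+, T2 (b n) = if (n : ℕ) % 2 = 0 then b (collatz n) else 0) :
    (∀ M : Submodule ℂ H, IsClosed (M : Set H) →
      (∀ A ∈ CstarGen {T1, T2}, ∀ x ∈ M, A x ∈ M ∧ ContinuousLinearMap.adjoint A x ∈ M) →
      M = ⊥ ∨ M = ⊤) ↔
      ∀ m : ℕ+, (1 : ℕ+) ∈ orbit collatz m := by
  have h1 : IsShift b 1 T1 := by
    intro n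
    rw [hT1 n]
    split_ifs with h
    · congr 1
      apply PNat.eq
      rw [collatz_odd n h]
      simp
    · rfl
  have h2 : IsShift b 0 T2 := hT2
  have c1 : collatz 1 = 4 := by decide
  have c4 : collatz 4 = 2 := by decide
  have c2 : collatz 2 = 1 := by decide
  constructor
  · intro hirr
    have hS : ∀ n, (1 : ℕ+) ∈ orbit collatz (collatz n) ↔ (1 : ℕ+) ∈ orbit collatz n := by
      intro n
      constructor
      · rintro ⟨k, hk⟩
        exact ⟨k + 1, hk⟩
      · rintro ⟨k, hk⟩
        rcases k with _ | k
        · have hk' : n = 1 := hk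
          subst hk'
          refine ⟨2, ?_⟩
          simp [c1, c4, c2]
        · exact ⟨k, hk⟩
    let M : Submodule ℂ H :=
      ⨅ n : {n : ℕ+ // (1 : ℕ+) ∉ orbit collatz n}, LinearMap.ker (innerSL ℂ (b n)).toLinearMap
    have memM : ∀ x, x ∈ M ↔ ∀ n, (1 : ℕ+) ∉ orbit collatz n → inner ℂ (b n) x = (0 : ℂ) := by
      intro x
      simp [M, Submodule.mem_iInf]
    have hMc : IsClosed (M : Set H) := by
      have : (M : Set H) = ⋂ n : {n : ℕ+ // (1 : ℕ+) ∉ orbit collatz n},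
          {x | inner ℂ (b n) x = (0 : ℂ)} := by
        ext x
        simp [memM]
      rw [this]
      exact isClosed_iInter fun n => isClosed_eq (by fun_prop) (by fun_prop)
    have inv : ∀ r T, IsShift b r T → ∀ x ∈ M, T x ∈ M ∧ ContinuousLinearMap.adjoint T x ∈ M := by
      intro r T hT x hx
      rw [memM] at hx
      constructor
      · rw [memM]
        intro n hn
        rw [← ContinuousLinearMap.adjoint_inner_left]
        by_cases hk : ∃ k : ℕ+, (k : ℕ) % 2 = r ∧ collatz k = n
        · obtain ⟨k, hk, rfl⟩ := hk
          rw [adj_shift b r T hT k hk]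
          exact hx k (fun h => hn ((hS k).2 h))
        · rw [adj_shift_zero b r T hT n (fun k h e => hk ⟨k, h, e⟩), inner_zero_left]
      · rw [memM]
        intro n hn
        rw [ContinuousLinearMap.adjoint_inner_right, hT n]
        split_ifs
        · exact hx _ (fun h => hn ((hS n).1 h))
        · exact inner_zero_left _
    have hM := hirr M hMc (gen_invariant _ M hMc (by
      rintro A (rfl | rfl)
      · exact inv 1 _ h1
      · exact inv 0 _ h2))
    have hb : ∀ m, b m ∈ M ↔ (1 : ℕ+) ∈ orbit collatz m := by
      intro m
      rw [memM]
      constructor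
      · intro h
        by_contra hm
        have := h m hm
        rw [inner_basis] at this
        simp at this
      · intro h n hn
        rw [inner_basis, if_neg]
        rintro rfl
        exact hn h
    have hb1 : b 1 ∈ M := (hb 1).2 ⟨0, rfl⟩
    have hne : b 1 ≠ 0 := b.orthonormal.ne_zero 1
    rcases hM with hM | hM
    · rw [hM] at hb1
      exact absurd ((Submodule.mem_bot ℂ).1 hb1) hne
    · intro m
      rw [← hb, hM]
      trivial
  · intro hc M hMc hM
    have i1 := hM T1 (subset_closure (NonUnitalStarAlgebra.subset_adjoin ℂ _ (by simp)))
    have i2 := hM T2 (subset_closure (NonUnitalStarAlgebra.subset_adjoin ℂ _ (by simp)))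
    have o : ∀ T : H →L[ℂ] H, (∀ x ∈ M, T x ∈ M) →
        ∀ y ∈ Mᗮ, ContinuousLinearMap.adjoint T y ∈ Mᗮ := by
      intro T hT y hy
      rw [Submodule.mem_orthogonal] at hy ⊢
      intro u hu
      rw [ContinuousLinearMap.adjoint_inner_right]
      exact hy _ (hT u hu)
    have o1 := o T1 (fun x hx => (i1 x hx).1)
    have o2 := o T2 (fun x hx => (i2 x hx).1)
    have : CompleteSpace M := hMc.completeSpace_coe
    obtain ⟨x, hx, y, hy, hxy⟩ := M.exists_add_mem_mem_orthogonal (b 1)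
    let W : H →L[ℂ] H := (ContinuousLinearMap.adjoint T1).comp
      ((ContinuousLinearMap.adjoint T2).comp (ContinuousLinearMap.adjoint T2))
    have hW : W (b 1) = b 1 := by
      have a1 := adj_shift b 0 T2 h2 2 (by decide)
      have a2 := adj_shift b 0 T2 h2 4 (by decide)
      have a3 := adj_shift b 1 T1 h1 1 (by decide)
      rw [c2] at a1
      rw [c4] at a2
      rw [c1] at a3
      simp [W, a1, a2, a3]
    have hWx : W x ∈ M := (i1 _ (i2 _ (i2 x hx).2).2).2
    have hWy : W y ∈ Mᗮ := o1 _ (o2 _ (o2 y hy))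
    have e : W x - x = y - W y := by
      rw [hxy, map_add] at hW
      rw [sub_eq_sub_iff_add_eq_add, hW, add_comm]
    have z : W x - x = 0 := by
      have m1 : W x - x ∈ M := M.sub_mem hWx hx
      have m2 : W x - x ∈ Mᗮ := by
        rw [e]
        exact Mᗮ.sub_mem hy hWy
      exact inner_self_eq_zero.1 (Submodule.inner_right_of_mem_orthogonal m1 m2)
    have fx : W x = x := sub_eq_zero.1 z
    have fy : W y = y := by
      rw [z] at e
      exact (sub_eq_zero.1 e.symm).symm
    have ex := fixed_mem b T1 T2 h1 h2 x fx
    have ey := fixed_mem b T1 T2 h1 h2 y fy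
    by_cases hx0 : (inner ℂ (b 1) x : ℂ) = 0
    · left
      rw [hx0, zero_smul] at ex
      rw [ex, zero_add] at hxy
      have t := top_of_one_mem b T1 T2 h1 h2 hc Mᗮ M.isClosed_orthogonal o1 o2 (hxy ▸ hy)
      exact (Submodule.orthogonal_eq_top_iff M).1 t
    · right
      refine top_of_one_mem b T1 T2 h1 h2 hc M hMc (fun x hx => (i1 x hx).2)
        (fun x hx => (i2 x hx).2) ?_
      rw [ex] at hx
      exact (M.smul_mem_iff hx0).1 hx
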